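/- Let A be a commutative associative k-algebra generated as a k-algebra by a subset X ⊂ A, let p ≥ 1, and let F be a k-linear endomorphism of A. Then F is a differential operator of order ≤ p if and only if Σ_{S ⊂ {1,…,p+q}} (-1)^{#S}·x_{S^c}·F(x_S) = 0 for all q ≥ 0 and all x_1,…,x_{p+q} ∈ X. -/

import Mathlib

noncomputable section

/-- A `k`-linear endomorphism `F` of a commutative associative `k`-algebra `A` is a
differential operator of order `≤ p` (in the convention (21) of the paper) if
`∑_{S ⊆ {1,…,p}} (-1)^{#S} a_{S^c} F(a_S b) = 0` for all `a_1,…,a_p, b ∈ A`,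
where `a_S` denotes the product of the `a_i` for `i ∈ S` (and `a_∅ = 1`). -/
def IsDiffOpOrderLE (k : Type) [Field k] (A : Type) [CommRing A] [Algebra k A]
    (p : ℕ) (F : A →ₗ[k] A) : Prop :=
  ∀ (a : Fin p → A) (b : A),
    ∑ T : Finset (Fin p),
      (-1 : A) ^ T.card * (∏ i ∈ Tᶜ, a i) * F ((∏ i ∈ T, a i) * b) = 0

section CommutatorFiltration

variable {k : Type} [Field k] {A : Type} [CommRing A] [Algebra k A]

/-- The commutator `G ↦ x G - G x` of multiplication by `x` with an endomorphism `G`. -/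
def mulCommutator (x : A) : Module.End k A →ₗ[k] Module.End k A :=
  LinearMap.mulLeft k (Algebra.lmul k A x) - LinearMap.mulRight k (Algebra.lmul k A x)

@[simp]
theorem mulCommutator_apply (x : A) (G : Module.End k A) (b : A) :
    mulCommutator x G b = x * G b - G (x * b) := by
  simp [mulCommutator]

/-- The endomorphisms all of whose `n`-fold commutators with multiplications by elements of `X`
vanish. -/
def commutatorFiltration (k : Type) [Field k] {A : Type} [CommRing A] [Algebra k A] (X : Set A) :
    ℕ → Submodule k (Module.End k A)
  | 0 => ⊥
  | n + 1 => ⨅ x ∈ X, (commutatorFiltration k X n).comap (mulCommutator x)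

theorem mem_commutatorFiltration_zero {X : Set A} {G : Module.End k A} :
    G ∈ commutatorFiltration k X 0 ↔ G = 0 := by
  simp [commutatorFiltration]

theorem mem_commutatorFiltration_succ {X : Set A} {n : ℕ} {G : Module.End k A} :
    G ∈ commutatorFiltration k X (n + 1) ↔
      ∀ x ∈ X, mulCommutator x G ∈ commutatorFiltration k X n := by
  simp [commutatorFiltration]

theorem lmul_mul_mem_commutatorFiltration {X : Set A} {n : ℕ} (a : A) {G : Module.End k A}
    (hG : G ∈ commutatorFiltration k X n) :
    Algebra.lmul k A a * G ∈ commutatorFiltration k X n := by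
  induction n generalizing G with
  | zero => simp_all [mem_commutatorFiltration_zero]
  | succ n ih =>
    rw [mem_commutatorFiltration_succ] at hG ⊢
    intro x hx
    convert ih (hG x hx) using 1
    ext b
    simp
    ring

theorem mul_lmul_mem_commutatorFiltration {X : Set A} {n : ℕ} (a : A) {G : Module.End k A}
    (hG : G ∈ commutatorFiltration k X n) :
    G * Algebra.lmul k A a ∈ commutatorFiltration k X n := by
  induction n generalizing G with
  | zero => simp_all [mem_commutatorFiltration_zero]
  | succ n ih =>
    rw [mem_commutatorFiltration_succ] at hG ⊢
    intro x hx
    convert ih (hG x hx) using 1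
    ext b
    simp [mul_left_comm]

theorem commutatorFiltration_mono (X : Set A) : Monotone (commutatorFiltration k X) := by
  refine monotone_nat_of_le_succ fun n => ?_
  induction n with
  | zero => exact bot_le
  | succ n ih =>
    intro G hG
    rw [mem_commutatorFiltration_succ] at hG ⊢
    exact fun x hx => ih (hG x hx)

theorem mulCommutator_mem_of_adjoin_eq_top {X : Set A} (hX : Algebra.adjoin k X = ⊤) {n : ℕ}
    {G : Module.End k A} (hG : G ∈ commutatorFiltration k X (n + 1)) (a : A) :
    mulCommutator a G ∈ commutatorFiltration k X n := by
  have ha : a ∈ Algebra.adjoin k X := hX ▸ Algebra.mem_top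
  induction ha using Algebra.adjoin_induction with
  | mem x hx => exact mem_commutatorFiltration_succ.1 hG x hx
  | algebraMap r =>
    convert zero_mem (commutatorFiltration k X n)
    ext b
    simp [← Algebra.smul_def]
  | add a b _ _ iha ihb =>
    convert add_mem iha ihb using 1
    ext c
    simp [add_mul]
    ring
  | mul a b _ _ iha ihb =>
    convert add_mem (lmul_mul_mem_commutatorFiltration a ihb)
      (mul_lmul_mem_commutatorFiltration b iha) using 1
    ext c
    simp [mul_assoc]
    ring

theorem commutatorFiltration_le_univ {X : Set A} (hX : Algebra.adjoin k X = ⊤) (n : ℕ) :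
    commutatorFiltration k X n ≤ commutatorFiltration k Set.univ n := by
  induction n with
  | zero => exact le_rfl
  | succ n ih =>
    intro G hG
    exact mem_commutatorFiltration_succ.2 fun a _ =>
      ih (mulCommutator_mem_of_adjoin_eq_top hX hG a)

theorem commutatorFiltration_univ_le (X : Set A) (n : ℕ) :
    commutatorFiltration k Set.univ n ≤ commutatorFiltration k X n := by
  induction n with
  | zero => exact le_rfl
  | succ n ih =>
    intro G hG
    rw [mem_commutatorFiltration_succ] at hG ⊢
    exact fun x _ => ih (hG x (Set.mem_univ x))

/-- The alternating sum `∑_{T ⊆ s} (-1)^{#T} a_{s \ T} G(a_T b)`. -/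
def altSum {ι : Type} [DecidableEq ι] (G : Module.End k A) (a : ι → A) (s : Finset ι) (b : A) : A :=
  ∑ T ∈ s.powerset, (-1 : A) ^ T.card * (∏ i ∈ s \ T, a i) * G ((∏ i ∈ T, a i) * b)

@[simp]
theorem altSum_empty {ι : Type} [DecidableEq ι] (G : Module.End k A) (a : ι → A) (b : A) :
    altSum G a ∅ b = G b := by
  simp [altSum]

theorem altSum_insert {ι : Type} [DecidableEq ι] (G : Module.End k A) (a : ι → A) {s : Finset ι}
    {i : ι} (hi : i ∉ s) (b : A) :
    altSum G a (insert i s) b = altSum (mulCommutator (a i) G) a s b := by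
  unfold altSum
  rw [Finset.sum_powerset_insert hi, ← Finset.sum_add_distrib]
  refine Finset.sum_congr rfl fun T hT => ?_
  have hiT : i ∉ T := fun h => hi (Finset.mem_powerset.1 hT h)
  rw [Finset.insert_sdiff_of_notMem s hiT, Finset.prod_insert (by simp [hi]),
    Finset.card_insert_of_notMem hiT, Finset.prod_insert hiT, Finset.insert_sdiff_insert,
    Finset.sdiff_insert_of_notMem hi, mulCommutator_apply, mul_assoc (a i)]
  ring

theorem altSum_map {ι κ : Type} [DecidableEq ι] [DecidableEq κ] (f : ι ↪ κ) (G : Module.End k A)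
    (a : κ → A) (s : Finset ι) (b : A) :
    altSum G a (s.map f) b = altSum G (a ∘ f) s b := by
  induction s using Finset.induction_on generalizing G with
  | empty => simp
  | insert i s hi ih =>
    rw [Finset.map_insert, altSum_insert _ _ (by simpa using hi), altSum_insert _ _ hi, ih]
    rfl

theorem altSum_cons {n : ℕ} (G : Module.End k A) (x : A) (a : Fin n → A) (b : A) :
    altSum G (Fin.cons x a : Fin (n + 1) → A) Finset.univ b =
      altSum (mulCommutator x G) a Finset.univ b := by
  rw [Fin.univ_succ, Finset.cons_eq_insert, altSum_insert _ _ (by simp), altSum_map]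
  rfl

theorem altSum_eq_zero {ι : Type} [DecidableEq ι] {X : Set A} {s : Finset ι} {G : Module.End k A}
    (hG : G ∈ commutatorFiltration k X s.card) {a : ι → A} (ha : ∀ i ∈ s, a i ∈ X) (b : A) :
    altSum G a s b = 0 := by
  induction s using Finset.induction_on generalizing G with
  | empty => simp [mem_commutatorFiltration_zero.1 hG]
  | insert i s hi ih =>
    rw [Finset.card_insert_of_notMem hi, mem_commutatorFiltration_succ] at hG
    rw [altSum_insert _ _ hi]
    exact ih (hG _ (ha i (by simp))) fun j hj => ha j (by simp [hj])

theorem mem_commutatorFiltration_of_altSum_eq_zero {X : Set A} {n : ℕ} {G : Module.End k A}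
    (h : ∀ a : Fin n → A, (∀ i, a i ∈ X) → ∀ b, altSum G a Finset.univ b = 0) :
    G ∈ commutatorFiltration k X n := by
  induction n generalizing G with
  | zero =>
    rw [mem_commutatorFiltration_zero]
    ext b
    simpa using h Fin.elim0 (fun i => i.elim0) b
  | succ n ih =>
    refine mem_commutatorFiltration_succ.2 fun x hx => ih fun a ha b => ?_
    rw [← altSum_cons]
    exact h _ (Fin.cases hx ha) b

theorem eq_zero_of_altSum_one_eq_zero {X : Set A} (hX : Algebra.adjoin k X = ⊤)
    {G : Module.End k A}
    (h : ∀ (n : ℕ) (a : Fin n → A), (∀ i, a i ∈ X) → altSum G a Finset.univ 1 = 0) : G = 0 := by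
  have key : ∀ m ∈ Submonoid.closure X, G m = 0 := by
    intro m hm
    induction hm using Submonoid.closure_induction_left generalizing G with
    | one => simpa using h 0 Fin.elim0 fun i => i.elim0
    | mul_left x hx m _ ih =>
      have hxG := ih (G := mulCommutator x G) fun n a ha => by
        rw [← altSum_cons]
        exact h _ _ (Fin.cases hx ha)
      simpa [ih h] using hxG
  refine LinearMap.ext_on (s := (Submonoid.closure X : Set A)) ?_ fun m hm => key m hm
  rw [← Algebra.adjoin_eq_span, hX, Algebra.top_toSubmodule]

theorem mem_commutatorFiltration_of_altSum_one_eq_zero {X : Set A} (hX : Algebra.adjoin k X = ⊤)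
    {p : ℕ} {G : Module.End k A}
    (h : ∀ n, p ≤ n → ∀ a : Fin n → A, (∀ i, a i ∈ X) → altSum G a Finset.univ 1 = 0) :
    G ∈ commutatorFiltration k X p := by
  induction p generalizing G with
  | zero =>
    exact mem_commutatorFiltration_zero.2
      (eq_zero_of_altSum_one_eq_zero hX fun n => h n n.zero_le)
  | succ p ih =>
    refine mem_commutatorFiltration_succ.2 fun x hx => ih fun n hn a ha => ?_
    rw [← altSum_cons]
    exact h _ (Nat.succ_le_succ hn) _ (Fin.cases hx ha)

theorem altSum_univ {ι : Type} [Fintype ι] [DecidableEq ι] (G : Module.End k A) (a : ι → A)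
    (b : A) :
    altSum G a Finset.univ b =
      ∑ T : Finset ι, (-1 : A) ^ T.card * (∏ i ∈ Tᶜ, a i) * G ((∏ i ∈ T, a i) * b) := by
  simp [altSum, Finset.compl_eq_univ_sdiff]

theorem isDiffOpOrderLE_iff_mem_commutatorFiltration {p : ℕ} {F : A →ₗ[k] A} :
    IsDiffOpOrderLE k A p F ↔ F ∈ commutatorFiltration k (Set.univ : Set A) p := by
  refine ⟨fun h => mem_commutatorFiltration_of_altSum_eq_zero fun a _ b => ?_, fun h a b => ?_⟩
  · rw [altSum_univ]
    exact h a b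
  · rw [← altSum_univ]
    exact altSum_eq_zero (X := Set.univ) (by simpa using h) (by simp) b

end CommutatorFiltration

/-- The equivalence of (21) and (22) in the paper: if the commutative associative
`k`-algebra `A` is generated as a `k`-algebra by a subset `X ⊆ A`, then a `k`-linear
endomorphism `F` of `A` is a differential operator of order `≤ p` if and only if
`∑_{S ⊆ {1,…,p+q}} (-1)^{#S} x_{S^c} F(x_S) = 0` for all `q ≥ 0` and all
`x_1,…,x_{p+q} ∈ X`. -/
theorem isDiffOp_iff_on_generators (k : Type) [Field k] [CharZero k]
    (A : Type) [CommRing A] [Algebra k A]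
    (X : Set A) (hX : Algebra.adjoin k X = ⊤)
    (p : ℕ) (hp : 1 ≤ p) (F : A →ₗ[k] A) :
    IsDiffOpOrderLE k A p F ↔
      ∀ (q : ℕ) (x : Fin (p + q) → A), (∀ i, x i ∈ X) →
        ∑ T : Finset (Fin (p + q)),
          (-1 : A) ^ T.card * (∏ i ∈ Tᶜ, x i) * F (∏ i ∈ T, x i) = 0 := by
  rw [isDiffOpOrderLE_iff_mem_commutatorFiltration]
  have hsum (n : ℕ) (x : Fin n → A) :
      ∑ T : Finset (Fin n), (-1 : A) ^ T.card * (∏ i ∈ Tᶜ, x i) * F (∏ i ∈ T, x i) =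
        altSum F x Finset.univ 1 := by
    simp [altSum_univ]
  simp only [hsum]
  constructor
  · intro h q x hx
    refine altSum_eq_zero (X := X) ?_ (fun i _ => hx i) 1
    rw [Finset.card_univ, Fintype.card_fin]
    exact commutatorFiltration_mono X (Nat.le_add_right p q) (commutatorFiltration_univ_le X p h)
  · intro h
    refine commutatorFiltration_le_univ hX p
      (mem_commutatorFiltration_of_altSum_one_eq_zero hX fun n hn => ?_)
    obtain ⟨q, rfl⟩ := Nat.exists_eq_add_of_le hn
    exact h q

end
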